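/- arXiv:1902.08821 — 3 statements merged into one kernel-verified Lean document; each statement's English description precedes it below -/
import Mathlib

section
/- Let r ∈ ℝ, σ̂ > 0, v > 0, K > 0 and 0 ≤ t₀ < T, and set τ = T − t₀, z = (1/σ̂)·log(K/v) + (σ̂/2 − r/σ̂)·τ, d₁ = (−z + σ̂·τ)/√τ and d₂ = −z/√τ. Then the discounted expected payoff of a European put on the VolTarget portfolio satisfies ∫_ℝ e^{−r·τ} · max(K − v·exp((r − σ̂²/2)·τ + σ̂·x), 0) dγ(x) = K·e^{−r·τ}·N(−d₂) − v·N(−d₁), where γ is the Gaussian measure on ℝ with mean 0 and variance τ and N is the cumulative distribution function of the standard normal distribution. -/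
open MeasureTheory ProbabilityTheory Real

/-- The cumulative distribution function of the standard normal distribution. -/
noncomputable def stdNormalCDF (x : ℝ) : ℝ :=
  ∫ t in Set.Iic x, (1 / Real.sqrt (2 * Real.pi)) * Real.exp (-t ^ 2 / 2)

theorem stdNormalCDF_eq_gaussianReal_real_Iic (x : ℝ) :
    stdNormalCDF x = (gaussianReal 0 1).real (Set.Iic x) := by
  rw [measureReal_def, gaussianReal_apply_eq_integral _ one_ne_zero, ENNReal.toReal_ofReal
    (integral_nonneg fun t => gaussianPDFReal_nonneg _ _ _), stdNormalCDF]
  simp [gaussianPDFReal]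

theorem gaussianReal_real_Iic {s : ℝ} (hs : 0 < s) (m a : ℝ) :
    (gaussianReal m s.toNNReal).real (Set.Iic a) = stdNormalCDF ((a - m) / √s) := by
  have hsqrt : 0 < √s := Real.sqrt_pos.mpr hs
  have hmap : (gaussianReal m s.toNNReal).map (fun x => (x - m) / √s) = gaussianReal 0 1 := by
    have hvar : s.toNNReal / NNReal.mk (√s ^ 2) (sq_nonneg _) = 1 := by
      apply NNReal.eq
      rw [NNReal.coe_div, Real.coe_toNNReal s hs.le, NNReal.coe_mk, Real.sq_sqrt hs.le,
        div_self hs.ne', NNReal.coe_one]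
    rw [show (fun x => (x - m) / √s) = (· / √s) ∘ (· - m) from rfl,
      ← Measure.map_map (by fun_prop) (by fun_prop),
      gaussianReal_map_sub_const, gaussianReal_map_div_const, sub_self, zero_div, hvar]
  rw [stdNormalCDF_eq_gaussianReal_real_Iic, ← hmap,
    map_measureReal_apply (by fun_prop) measurableSet_Iic]
  congr 1
  ext x
  simp [div_le_div_iff_of_pos_right hsqrt]

theorem setIntegral_exp_mul_gaussianReal {s : ℝ} (hs : 0 < s) (c : ℝ) {A : Set ℝ}
    (hA : MeasurableSet A) :
    ∫ x in A, exp (c * x) ∂(gaussianReal 0 s.toNNReal) =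
      exp (s * c ^ 2 / 2) * (gaussianReal (s * c) s.toNNReal).real A := by
  have hne : s.toNNReal ≠ 0 := (Real.toNNReal_pos.mpr hs).ne'
  rw [measureReal_def, gaussianReal_apply_eq_integral _ hne, ENNReal.toReal_ofReal
    (integral_nonneg fun t => gaussianPDFReal_nonneg _ _ _), ← integral_indicator hA,
    integral_gaussianReal_eq_integral_smul hne, ← integral_const_mul, ← integral_indicator hA]
  refine integral_congr_ae (.of_forall fun x => ?_)
  by_cases hx : x ∈ A
  · simp only [hx, Set.indicator_of_mem, smul_eq_mul, gaussianPDFReal, Real.coe_toNNReal s hs.le]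
    rw [mul_left_comm, mul_assoc, ← Real.exp_add, ← Real.exp_add]
    congr 2
    field_simp
    ring
  · simp [hx]

/-- Closed-end formula for the price of a European put option on a standard
VolTarget strategy portfolio. -/
theorem volTarget_put_price (r σh v K t₀ T : ℝ) (hσ : 0 < σh) (hv : 0 < v)
    (hK : 0 < K) (ht₀ : 0 ≤ t₀) (hT : t₀ < T) :
    let τ := T - t₀
    let z := (1 / σh) * Real.log (K / v) + (σh / 2 - r / σh) * τ
    let d₁ := (-z + σh * τ) / Real.sqrt τ
    let d₂ := -z / Real.sqrt τ
    (∫ x, Real.exp (-r * τ) *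
        max (K - v * Real.exp ((r - σh ^ 2 / 2) * τ + σh * x)) 0
        ∂(gaussianReal 0 (Real.toNNReal τ))) =
      K * Real.exp (-r * τ) * stdNormalCDF (-d₂) - v * stdNormalCDF (-d₁) := by
  intro τ z d₁ d₂
  have hτ : 0 < τ := sub_pos.mpr hT
  have hexercise (x : ℝ) : v * exp ((r - σh ^ 2 / 2) * τ + σh * x) ≤ K ↔ x ≤ z := by
    have hlog : σh * z = log (K / v) - (r - σh ^ 2 / 2) * τ := by
      simp only [z]
      field_simp
      ring
    rw [← le_div_iff₀' hv, ← Real.le_log_iff_exp_le (div_pos hK hv),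
      ← mul_le_mul_iff_right₀ (b := x) hσ, hlog, le_sub_iff_add_le']
  have hpayoff (x : ℝ) : exp (-r * τ) * max (K - v * exp ((r - σh ^ 2 / 2) * τ + σh * x)) 0 =
      (Set.Iic z).indicator
        (fun x => K * exp (-r * τ) - v * exp (-(τ * σh ^ 2 / 2)) * exp (σh * x)) x := by
    by_cases hx : x ≤ z
    · have hsplit : exp (-r * τ) * exp ((r - σh ^ 2 / 2) * τ + σh * x) =
          exp (-(τ * σh ^ 2 / 2)) * exp (σh * x) := by
        rw [← Real.exp_add, ← Real.exp_add]
        congr 1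
        ring
      rw [Set.indicator_of_mem (Set.mem_Iic.mpr hx),
        max_eq_left (sub_nonneg.mpr ((hexercise x).mpr hx))]
      linear_combination -v * hsplit
    · rw [Set.indicator_of_notMem (by simpa using hx), max_eq_right, mul_zero]
      exact sub_nonpos.mpr (not_le.mp (mt (hexercise x).mp hx)).le
  have hd₁ : -d₁ = (z - τ * σh) / √τ := by
    simp only [d₁]
    ring
  have hd₂ : -d₂ = (z - 0) / √τ := by
    simp only [d₂]
    ring
  simp_rw [hpayoff]
  rw [integral_indicator measurableSet_Iic, integral_sub (integrable_const _)
      ((integrable_exp_mul_gaussianReal σh).integrableOn.const_mul _),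
    setIntegral_const, integral_const_mul, setIntegral_exp_mul_gaussianReal hτ _ measurableSet_Iic,
    gaussianReal_real_Iic hτ, gaussianReal_real_Iic hτ, hd₁, hd₂, smul_eq_mul, Real.exp_neg]
  field_simp
end

section
/- Let r ∈ ℝ, K > 0, σ̂ > 0, σ > 0, τ > 0 and s > 0. Define Π(v) = v·N(d₁(v)) − K·e^{−r·τ}·N(d₂(v)) with d₁(v) = (log(v/K) + (r + σ̂²/2)·τ)/(σ̂·√τ) and d₂(v) = (log(v/K) + (r − σ̂²/2)·τ)/(σ̂·√τ). If g : ℝ → ℝ is differentiable at s with g(s) = v > 0 and g′(s) = v·σ̂/(s·σ), then the composition Π ∘ g is differentiable at s and (Π ∘ g)′(s) = (v·σ̂/(s·σ))·N(d₁(v)). -/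
open Real

theorem hasDerivAt_stdNormalCDF (x : ℝ) :
    HasDerivAt stdNormalCDF ((1 / Real.sqrt (2 * Real.pi)) * Real.exp (-x ^ 2 / 2)) x := by
  set f : ℝ → ℝ := fun t => (1 / Real.sqrt (2 * Real.pi)) * Real.exp (-t ^ 2 / 2) with hf
  have hcont : Continuous f := by fun_prop
  have hint : MeasureTheory.Integrable f := by
    refine ((integrable_exp_neg_mul_sq (b := 1 / 2) (by norm_num)).const_mul
      (1 / Real.sqrt (2 * Real.pi))).congr (Filter.Eventually.of_forall fun t => ?_)
    simp only [hf]
    ring_nf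
  have hsplit : stdNormalCDF = fun y => stdNormalCDF 0 + ∫ t in (0 : ℝ)..y, f t := by
    funext y
    rw [← intervalIntegral.integral_Iic_sub_Iic hint.integrableOn hint.integrableOn]
    simp only [stdNormalCDF, hf]
    ring
  rw [hsplit]
  exact (intervalIntegral.integral_hasDerivAt_right (hcont.intervalIntegrable 0 x)
    hcont.aestronglyMeasurable.stronglyMeasurableAtFilter hcont.continuousAt).const_add _

/-- With `a = σ̂√τ`, the two density terms in the derivative of the call price cancel. -/
theorem mul_exp_neg_sq_eq {K v a b : ℝ} (hK : 0 < K) (hv : 0 < v) (ha : a ≠ 0) :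
    v * Real.exp (-((Real.log (v / K) + (b + a ^ 2 / 2)) / a) ^ 2 / 2) =
      K * Real.exp (-b) * Real.exp (-((Real.log (v / K) + (b - a ^ 2 / 2)) / a) ^ 2 / 2) := by
  have hexp : -((Real.log (v / K) + (b + a ^ 2 / 2)) / a) ^ 2 / 2 =
      -Real.log (v / K) + (-b + -((Real.log (v / K) + (b - a ^ 2 / 2)) / a) ^ 2 / 2) := by
    field_simp
    ring
  rw [hexp, Real.exp_add, Real.exp_add, Real.exp_neg (Real.log _), Real.exp_log (by positivity)]
  field_simp

/-- Delta of a call option on a VolTarget portfolio: if the portfolio value `g`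
has sensitivity `v·σ̂/(s·σ)` with respect to the risky-asset price `s`, then the
option price has sensitivity `(v·σ̂/(s·σ))·N(d₁(v))` with respect to `s`. -/
theorem volTarget_call_delta (r K σh σ τ s v : ℝ) (hK : 0 < K) (hσh : 0 < σh)
    (hσ : 0 < σ) (hτ : 0 < τ) (hs : 0 < s) (hv : 0 < v) (g : ℝ → ℝ)
    (hg : HasDerivAt g (v * σh / (s * σ)) s) (hgs : g s = v) :
    let d₁ : ℝ → ℝ := fun w =>
      (Real.log (w / K) + (r + σh ^ 2 / 2) * τ) / (σh * Real.sqrt τ)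
    let d₂ : ℝ → ℝ := fun w =>
      (Real.log (w / K) + (r - σh ^ 2 / 2) * τ) / (σh * Real.sqrt τ)
    let callPrice : ℝ → ℝ := fun w =>
      w * stdNormalCDF (d₁ w) - K * Real.exp (-r * τ) * stdNormalCDF (d₂ w)
    HasDerivAt (callPrice ∘ g) (v * σh / (s * σ) * stdNormalCDF (d₁ v)) s := by
  intro d₁ d₂ callPrice
  have ha : σh * Real.sqrt τ ≠ 0 := by positivity
  have hsq : (σh * Real.sqrt τ) ^ 2 = σh ^ 2 * τ := by rw [mul_pow, Real.sq_sqrt hτ.le]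
  have hlog : HasDerivAt (fun w => Real.log (w / K)) (1 / v) v := by
    have h := ((hasDerivAt_id' v).div_const K).log (by positivity)
    refine h.congr_deriv ?_
    field_simp
  have hd₁ : HasDerivAt d₁ (1 / v / (σh * Real.sqrt τ)) v := (hlog.add_const _).div_const _
  have hd₂ : HasDerivAt d₂ (1 / v / (σh * Real.sqrt τ)) v := (hlog.add_const _).div_const _
  have hcancel : v * Real.exp (-(d₁ v) ^ 2 / 2) =
      K * Real.exp (-r * τ) * Real.exp (-(d₂ v) ^ 2 / 2) := by
    have h := mul_exp_neg_sq_eq (b := r * τ) hK hv ha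
    rw [hsq] at h
    simp only [d₁, d₂, add_mul, sub_mul, neg_mul]
    simpa only [div_mul_eq_mul_div] using h
  have hprice : HasDerivAt callPrice (stdNormalCDF (d₁ v)) v := by
    have h := ((hasDerivAt_id v).mul ((hasDerivAt_stdNormalCDF (d₁ v)).comp v hd₁)).sub
      (((hasDerivAt_stdNormalCDF (d₂ v)).comp v hd₂).const_mul (K * Real.exp (-r * τ)))
    refine h.congr_deriv ?_
    simp only [id, Function.comp_apply]
    linear_combination (1 / Real.sqrt (2 * Real.pi)) * (1 / v / (σh * Real.sqrt τ)) * hcancel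
  rw [mul_comm]
  exact HasDerivAt.comp s (hgs.symm ▸ hprice) hg
end

section
/- Let r ∈ ℝ, K > 0, τ > 0, L ≥ 1 and σ > 0. For v > 0 define d̃₁(v) = (log(v/K) + (r + L²σ²/2)·τ)/(L·σ·√τ), and define the Vega function ν(v) = (v/√(2π))·exp(−d̃₁(v)²/2)·L·√τ. Then ν attains its unique maximum on (0, ∞) at v* = K·exp(−τ·(r − L²σ²/2)), i.e. ν(v*) ≥ ν(v) for all v > 0 with equality only at v = v*. -/
open Real

/-- The Vega of a call option on a VolTarget portfolio with maximum allowed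
leverage factor `L` (in the regime where the leverage cap is binding) attains
its unique maximum over the portfolio value at `v* = K·exp(−τ·(r − L²σ²/2))`. -/
theorem mlVolTarget_vega_unique_max (r K τ L σ : ℝ) (hK : 0 < K) (hτ : 0 < τ)
    (hL : 1 ≤ L) (hσ : 0 < σ) :
    let d₁ : ℝ → ℝ := fun v =>
      (Real.log (v / K) + (r + L ^ 2 * σ ^ 2 / 2) * τ) / (L * σ * Real.sqrt τ)
    let ν : ℝ → ℝ := fun v =>
      v / Real.sqrt (2 * Real.pi) * Real.exp (-(d₁ v) ^ 2 / 2) * L * Real.sqrt τ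
    let vstar := K * Real.exp (-τ * (r - L ^ 2 * σ ^ 2 / 2))
    ∀ v : ℝ, 0 < v → ν v ≤ ν vstar ∧ (ν v = ν vstar → v = vstar) := by
  intro d₁ ν vstar
  have hL₀ : 0 < L := one_pos.trans_le hL
  have hsqrt : 0 < √τ := Real.sqrt_pos.2 hτ
  have hτ_sq : √τ ^ 2 = τ := Real.sq_sqrt hτ.le
  set s := L * σ * √τ with hs
  have hs_pos : 0 < s := by positivity
  have hs_sq : s ^ 2 = L ^ 2 * σ ^ 2 * τ := by rw [hs, mul_pow, mul_pow, hτ_sq]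
  set C := K / √(2 * π) * Real.exp (-r * τ) * L * √τ with hC
  have hC_pos : 0 < C := by positivity
  have hlog (v : ℝ) : Real.log (v / K) = s * d₁ v - (r * τ + s ^ 2 / 2) := by
    have h : s * d₁ v = Real.log (v / K) + (r + L ^ 2 * σ ^ 2 / 2) * τ :=
      mul_div_cancel₀ _ hs_pos.ne'
    rw [h, hs_sq]
    ring
  have hv_eq {v : ℝ} (hv : 0 < v) : v = K * Real.exp (s * d₁ v - (r * τ + s ^ 2 / 2)) := by
    rw [← hlog, Real.exp_log (div_pos hv hK), mul_div_cancel₀ _ hK.ne']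
  have hν {v : ℝ} (hv : 0 < v) : ν v = C * Real.exp (-(d₁ v - s) ^ 2 / 2) := by
    have h : v * Real.exp (-(d₁ v) ^ 2 / 2) =
        K * (Real.exp (-r * τ) * Real.exp (-(d₁ v - s) ^ 2 / 2)) := by
      nth_rewrite 1 [hv_eq hv]
      rw [mul_assoc, ← Real.exp_add, ← Real.exp_add]
      ring_nf
    calc ν v = v * Real.exp (-(d₁ v) ^ 2 / 2) / √(2 * π) * L * √τ := by
          simp only [ν]
          ring
      _ = C * Real.exp (-(d₁ v - s) ^ 2 / 2) := by
          rw [h, hC]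
          ring
  have hvstar : 0 < vstar := by positivity
  have hd_star : d₁ vstar = s := by
    have h : Real.log (vstar / K) = -τ * (r - L ^ 2 * σ ^ 2 / 2) := by
      simp only [vstar]
      rw [mul_div_cancel_left₀ _ hK.ne', Real.log_exp]
    have h' := hlog vstar
    rw [h] at h'
    apply mul_left_cancel₀ hs_pos.ne'
    linear_combination -h' - hs_sq / 2
  have hν_star : ν vstar = C := by
    rw [hν hvstar, hd_star]
    simp
  intro v hv
  rw [hν_star, hν hv]
  refine ⟨mul_le_of_le_one_right hC_pos.le
    (Real.exp_le_one_iff.2 (by nlinarith [sq_nonneg (d₁ v - s)])), fun h => ?_⟩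
  have hexp : -(d₁ v - s) ^ 2 / 2 = 0 :=
    (Real.exp_eq_one_iff _).1 ((mul_eq_left₀ hC_pos.ne').1 h)
  have hd : d₁ v = s := sub_eq_zero.1 (pow_eq_zero_iff two_ne_zero |>.1 (by linarith))
  rw [hv_eq hv, hv_eq hvstar, hd, hd_star]
end
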